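/- arXiv:1010.4766 — 2 statements merged into one kernel-verified Lean document; each statement's English description precedes it below -/
import Mathlib

section
/- Let L be a number field. The partial products ∏_{𝔮 ∈ F} (1 − N(𝔮)^{−1}), taken over finite sets F of nonzero prime ideals of 𝓞_L, tend to 0 along the directed family of finite sets F ordered by inclusion; equivalently, the infimum over all finite sets F of ∏_{𝔮 ∈ F} (1 − N(𝔮)^{−1}) is 0. -/
open scoped NumberField
open IsDedekindDomain

open Filter Topology nonZeroDivisors

/-- If the reciprocals of the norms of the nonzero ideals were summable, then the nonzero ideals
would have density zero, contradicting the asymptotic count of ideals of bounded norm. -/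
theorem NumberField.not_summable_absNorm_inv (L : Type*) [Field L] [NumberField L] :
    ¬ Summable fun I : (Ideal (𝓞 L))⁰ => (Ideal.absNorm (I : Ideal (𝓞 L)) : ℝ)⁻¹ := by
  classical
  intro h
  have hlim := NumberField.Ideal.tendsto_norm_le_div_atTop₀ L
  rw [← NumberField.dedekindZeta_residue_def] at hlim
  set c := NumberField.dedekindZeta_residue L
  have hc0 : 0 < c := NumberField.dedekindZeta_residue_pos L
  obtain ⟨T, hT⟩ := summable_iff_vanishing_norm.1 h (c / 2) (half_pos hc0)
  have hbound : ∀ᶠ s : ℝ in atTop,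
      (Nat.card {I : (Ideal (𝓞 L))⁰ // Ideal.absNorm (I : Ideal (𝓞 L)) ≤ s} : ℝ) / s
        ≤ T.card / s + c / 2 := by
    filter_upwards [eventually_gt_atTop 0] with s hs
    have hfin : {I : (Ideal (𝓞 L))⁰ | (Ideal.absNorm (I : Ideal (𝓞 L)) : ℝ) ≤ s}.Finite := by
      simp_rw [← Nat.le_floor_iff hs.le]
      exact Ideal.finite_setOfPred_absNorm_le₀ ⌊s⌋₊
    set A := hfin.toFinset with hA
    have hcard : Nat.card {I : (Ideal (𝓞 L))⁰ // (Ideal.absNorm (I : Ideal (𝓞 L)) : ℝ) ≤ s}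
        = A.card := Nat.card_eq_card_finite_toFinset hfin
    rw [hcard]
    have hsplit : (A.card : ℝ) ≤ T.card + (A \ T).card := by
      have := Finset.card_le_card_sdiff_add_card (s := A) (t := T)
      rw [add_comm] at this
      exact_mod_cast this
    have htail : ((A \ T).card : ℝ) ≤ s * (c / 2) := by
      calc ((A \ T).card : ℝ) = ∑ I ∈ A \ T, (1 : ℝ) := by simp
        _ ≤ ∑ I ∈ A \ T, s * (Ideal.absNorm (I : Ideal (𝓞 L)) : ℝ)⁻¹ := by
          refine Finset.sum_le_sum fun I hI => ?_
          have hIs : (Ideal.absNorm (I : Ideal (𝓞 L)) : ℝ) ≤ s := by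
            simpa [hA] using (Finset.mem_sdiff.1 hI).1
          have hpos : (0 : ℝ) < Ideal.absNorm (I : Ideal (𝓞 L)) :=
            Nat.cast_pos.2 (Ideal.absNorm_pos_of_nonZeroDivisors I)
          rw [← div_eq_mul_inv]
          exact (one_le_div hpos).2 hIs
        _ = s * ∑ I ∈ A \ T, (Ideal.absNorm (I : Ideal (𝓞 L)) : ℝ)⁻¹ := by
          rw [Finset.mul_sum]
        _ ≤ s * (c / 2) := by
          gcongr
          exact (le_abs_self _).trans (hT _ Finset.sdiff_disjoint).le
    rw [div_add' _ _ _ hs.ne']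
    gcongr
    linarith
  have hrhs : Tendsto (fun s : ℝ => (T.card : ℝ) / s + c / 2) atTop (𝓝 (0 + c / 2)) :=
    (tendsto_const_nhds.div_atTop tendsto_id).add tendsto_const_nhds
  have := le_of_tendsto_of_tendsto hlim hrhs hbound
  linarith

/-- A finite set of nonzero ideals of a Dedekind domain factors over a common finite set of
primes. -/
theorem IsDedekindDomain.exists_finset_forall_eq_prod_pow {R : Type*} [CommRing R]
    [IsDedekindDomain R] (T : Finset (Ideal R)⁰) :
    ∃ (F : Finset (HeightOneSpectrum R)) (e : (Ideal R)⁰ → HeightOneSpectrum R → ℕ),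
      ∀ I ∈ T, (I : Ideal R) = ∏ q ∈ F, q.asIdeal ^ e I q := by
  classical
  have hfin (I : (Ideal R)⁰) := Ideal.hasFiniteMulSupport (nonZeroDivisors.ne_zero I.2)
  refine ⟨T.biUnion fun I => (hfin I).toFinset,
    fun I q => (Associates.mk q.asIdeal).count (Associates.mk (I : Ideal R)).factors,
    fun I hI => ?_⟩
  conv_lhs => rw [← Ideal.finprod_heightOneSpectrum_factorization (nonZeroDivisors.ne_zero I.2)]
  refine finprod_eq_prod_of_mulSupport_subset _ fun q hq => ?_
  exact Finset.mem_coe.2 (Finset.mem_biUnion.2 ⟨I, hI, (hfin I).mem_toFinset.2 hq⟩)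

/-- Every finite sum of reciprocals of norms of nonzero ideals is bounded by a finite Euler
product. -/
theorem NumberField.exists_sum_absNorm_inv_le_prod {L : Type*} [Field L] [NumberField L]
    (T : Finset (Ideal (𝓞 L))⁰) :
    ∃ F : Finset (HeightOneSpectrum (𝓞 L)),
      ∑ I ∈ T, (Ideal.absNorm (I : Ideal (𝓞 L)) : ℝ)⁻¹
        ≤ ∏ q ∈ F, (1 - (Ideal.absNorm q.asIdeal : ℝ)⁻¹)⁻¹ := by
  classical
  obtain ⟨F, e, he⟩ := IsDedekindDomain.exists_finset_forall_eq_prod_pow T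
  refine ⟨F, ?_⟩
  let x (q : HeightOneSpectrum (𝓞 L)) : ℝ := (Ideal.absNorm q.asIdeal : ℝ)⁻¹
  have hx0 (q) : 0 ≤ x q := by positivity
  have hx1 (q) : x q < 1 := inv_lt_one_of_one_lt₀ (by
    exact_mod_cast NumberField.HeightOneSpectrum.one_lt_absNorm q)
  let E (q : HeightOneSpectrum (𝓞 L)) : Finset ℕ := T.image fun I => e I q
  let φ (I : (Ideal (𝓞 L))⁰) : ∀ q ∈ F, ℕ := fun q _ => e I q
  have hφ : Set.InjOn φ T := fun I hI J hJ hIJ => by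
    apply Subtype.ext
    rw [he I hI, he J hJ]
    exact Finset.prod_congr rfl fun q hq => by rw [show e I q = e J q from congr_fun₂ hIJ q hq]
  calc ∑ I ∈ T, (Ideal.absNorm (I : Ideal (𝓞 L)) : ℝ)⁻¹
      = ∑ I ∈ T, ∏ q ∈ F.attach, x q.1 ^ φ I q.1 q.2 := by
        refine Finset.sum_congr rfl fun I hI => ?_
        rw [he I hI, Finset.prod_attach F fun q => x q ^ e I q]
        simp [x, map_prod]
    _ = ∑ p ∈ T.image φ, ∏ q ∈ F.attach, x q.1 ^ p q.1 q.2 :=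
        (Finset.sum_image (f := fun p : ∀ q ∈ F, ℕ => ∏ q ∈ F.attach, x q.1 ^ p q.1 q.2) hφ).symm
    _ ≤ ∑ p ∈ F.pi E, ∏ q ∈ F.attach, x q.1 ^ p q.1 q.2 := by
        refine Finset.sum_le_sum_of_subset_of_nonneg (fun p hp => ?_) fun p _ _ =>
          Finset.prod_nonneg fun q _ => pow_nonneg (hx0 _) _
        obtain ⟨I, hI, rfl⟩ := Finset.mem_image.1 hp
        exact Finset.mem_pi.2 fun q _ => Finset.mem_image_of_mem _ hI
    _ = ∏ q ∈ F, ∑ k ∈ E q, x q ^ k := (Finset.prod_sum F E fun q k => x q ^ k).symm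
    _ ≤ ∏ q ∈ F, (1 - x q)⁻¹ := by
        refine Finset.prod_le_prod (fun q _ => Finset.sum_nonneg fun k _ => pow_nonneg (hx0 q) k)
          fun q _ => ?_
        exact sum_le_hasSum _ (fun k _ => pow_nonneg (hx0 q) k)
          (hasSum_geometric_of_lt_one (hx0 q) (hx1 q))

/-- The partial products `∏_{𝔮 ∈ F} (1 - N(𝔮)⁻¹)` over finite sets
`F` of nonzero primes of `𝓞_L` tend to `0` along the directed family of finite sets;
equivalently, their infimum is `0`. -/
theorem prod_one_sub_norm_inv_tendsto_zero (L : Type*) [Field L] [NumberField L] :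
    Filter.Tendsto
        (fun F : Finset (HeightOneSpectrum (𝓞 L)) =>
          ∏ q ∈ F, (1 - (Ideal.absNorm q.asIdeal : ℝ)⁻¹))
        Filter.atTop (nhds 0) ∧
      ⨅ F : Finset (HeightOneSpectrum (𝓞 L)),
        ∏ q ∈ F, (1 - (Ideal.absNorm q.asIdeal : ℝ)⁻¹) = 0 := by
  set P := fun F : Finset (HeightOneSpectrum (𝓞 L)) =>
    ∏ q ∈ F, (1 - (Ideal.absNorm q.asIdeal : ℝ)⁻¹)
  have hfactor (q : HeightOneSpectrum (𝓞 L)) : 0 < 1 - (Ideal.absNorm q.asIdeal : ℝ)⁻¹ :=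
    sub_pos.2 (inv_lt_one_of_one_lt₀ (by
      exact_mod_cast NumberField.HeightOneSpectrum.one_lt_absNorm q))
  have hpos (F) : 0 < P F := Finset.prod_pos fun q _ => hfactor q
  have hbdd : BddBelow (Set.range P) := ⟨0, by rintro _ ⟨F, rfl⟩; exact (hpos F).le⟩
  have hanti : Antitone P :=
    Finset.prod_anti_set_of_le_one (fun q => (hfactor q).le) fun q => sub_le_self _ (by positivity)
  have hinf : ⨅ F, P F = 0 := by
    refine le_antisymm (le_of_forall_pos_le_add fun ε hε => ?_)
      (Real.iInf_nonneg fun F => (hpos F).le)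
    obtain ⟨T, hT⟩ : ∃ T : Finset (Ideal (𝓞 L))⁰,
        ε⁻¹ < ∑ I ∈ T, (Ideal.absNorm (I : Ideal (𝓞 L)) : ℝ)⁻¹ := by
      by_contra! h
      exact NumberField.not_summable_absNorm_inv L
        (summable_of_sum_le (fun _ => inv_nonneg.2 (Nat.cast_nonneg _)) h)
    obtain ⟨F, hF⟩ := NumberField.exists_sum_absNorm_inv_le_prod T
    rw [Finset.prod_inv_distrib] at hF
    have hlt : P F < ε := (inv_lt_inv₀ hε (hpos F)).1 (hT.trans_le hF)
    rw [zero_add]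
    exact (ciInf_le hbdd F).trans hlt.le
  exact ⟨hinf ▸ tendsto_atTop_ciInf hanti hbdd, hinf⟩
end

section
/- Let L/K be an extension of number fields with K ≠ L, and set n = [L:K] (so n ≥ 2). Then for every β with 0 < β ≤ 1 and every real number C, there exists a finite set F of nonzero prime ideals of 𝓞_K such that ∏_{𝔭 ∈ F} [ (1 − N_K(𝔭)^{−nβ}) / ∏_{𝔮 | 𝔭𝓞_L} (1 − N_L(𝔮)^{−β}) ] > C; that is, these partial products are unbounded above. -/
open scoped NumberField
open IsDedekindDomain

lemma summable_of_card_fiber_le {α β : Type*} (π : α → β) {f : α → ℝ} {g : β → ℝ} (n : ℕ)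
    (hcard : ∀ (b : β) (s : Finset α), (∀ a ∈ s, π a = b) → s.card ≤ n)
    (hf : ∀ a, 0 ≤ f a) (hg : ∀ b, 0 ≤ g b) (hfg : ∀ a, f a ≤ g (π a)) (hs : Summable g) :
    Summable f := by
  classical
  refine summable_of_sum_le hf (c := n * ∑' b, g b) fun s ↦ ?_
  calc ∑ a ∈ s, f a = ∑ b ∈ s.image π, ∑ a ∈ s with π a = b, f a :=
        (Finset.sum_fiberwise_of_maps_to (fun a ha ↦ Finset.mem_image_of_mem π ha) f).symm
    _ ≤ ∑ b ∈ s.image π, n * g b := by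
        refine Finset.sum_le_sum fun b _ ↦ ?_
        calc ∑ a ∈ s with π a = b, f a ≤ ∑ a ∈ s with π a = b, g b :=
              Finset.sum_le_sum fun a ha ↦ (Finset.mem_filter.mp ha).2 ▸ hfg a
          _ = (s.filter (π · = b)).card * g b := by simp
          _ ≤ n * g b := by
              gcongr
              · exact hg b
              · exact hcard b _ fun a ha ↦ (Finset.mem_filter.mp ha).2
    _ = n * ∑ b ∈ s.image π, g b := by rw [Finset.mul_sum]
    _ ≤ n * ∑' b, g b := by
        gcongr
        exact hs.sum_le_tsum _ fun b _ ↦ hg b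

lemma IsDedekindDomain.HeightOneSpectrum.card_fiber_under_le {A B : Type*}
    [CommRing A] [IsDedekindDomain A]
    [CommRing B] [IsDedekindDomain B] [Algebra A B] [Module.Finite A B] [Module.Flat A B]
    (p : HeightOneSpectrum A) (s : Finset (HeightOneSpectrum B))
    (hs : ∀ q ∈ s, q.under A = p) : s.card ≤ Module.finrank A B := by
  have := p.isMaximal
  have : Fintype (p.asIdeal.primesOver B) := Fintype.ofFinite _
  have hmem : ∀ q ∈ s, q.asIdeal ∈ p.asIdeal.primesOver B := fun q hq ↦
    ⟨q.isPrime, ⟨by rw [← hs q hq]; rfl⟩⟩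
  have h1 : s.card ≤ Fintype.card (p.asIdeal.primesOver B) := by
    rw [← Fintype.card_coe]
    refine Fintype.card_le_of_injective (fun q ↦ ⟨q.1.asIdeal, hmem q.1 q.2⟩) fun q r h ↦ ?_
    exact Subtype.ext (HeightOneSpectrum.ext (congrArg Subtype.val h))
  refine h1.trans ?_
  rw [← Ideal.sum_ramification_inertia_eq_finrank (S := B) p.asIdeal, ← Finset.card_univ,
    Finset.card_eq_sum_ones]
  refine Finset.sum_le_sum fun q _ ↦ ?_
  have := q.2.1
  exact Nat.mul_pos (Ideal.ramificationIdx_pos _ _) (Ideal.inertiaDeg_pos _ _)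


lemma one_add_sum_le_prod_one_add {ι : Type*} (s : Finset ι) {f : ι → ℝ} (hf : ∀ i, 0 ≤ f i) :
    1 + ∑ i ∈ s, f i ≤ ∏ i ∈ s, (1 + f i) := by
  classical
  induction s using Finset.induction_on with
  | empty => simp
  | insert a s ha ih =>
    rw [Finset.sum_insert ha, Finset.prod_insert ha]
    have := Finset.sum_nonneg fun i (_ : i ∈ s) ↦ hf i
    nlinarith [hf a, mul_nonneg (hf a) this, mul_le_mul_of_nonneg_left ih (hf a)]

lemma geom_sum_le_exp {x : ℝ} (hx0 : 0 ≤ x) (hx : x ≤ 1 / 2) (m : ℕ) :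
    ∑ k ∈ Finset.range m, x ^ k ≤ Real.exp (2 * x) := by
  calc ∑ k ∈ Finset.range m, x ^ k ≤ ∑' k, x ^ k :=
        (summable_geometric_of_lt_one hx0 (by linarith)).sum_le_tsum _ fun k _ ↦ by positivity
    _ = (1 - x)⁻¹ := tsum_geometric_of_lt_one hx0 (by linarith)
    _ ≤ 2 * x + 1 := by
        rw [inv_le_iff_one_le_mul₀ (by linarith)]
        nlinarith
    _ ≤ Real.exp (2 * x) := Real.add_one_le_exp _

open UniqueFactorizationMonoid in
lemma eq_prod_pow_count_normalizedFactors {A : Type*} [CommRing A] [IsDedekindDomain A]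
    [DecidableEq (Ideal A)] {I : Ideal A} (hI : I ≠ 0) (T : Finset (HeightOneSpectrum A))
    (hT : ∀ p : HeightOneSpectrum A, p.asIdeal ∈ normalizedFactors I → p ∈ T) :
    I = ∏ p : T, p.1.asIdeal ^ (normalizedFactors I).count p.1.asIdeal := by
  conv_lhs => rw [← Ideal.prod_normalizedFactors_eq_self hI]
  rw [Finset.prod_multiset_count_of_subset _ (T.image HeightOneSpectrum.asIdeal),
    Finset.prod_image fun _ _ _ _ ↦ HeightOneSpectrum.ext,
    Finset.prod_coe_sort T fun p ↦ p.asIdeal ^ (normalizedFactors I).count p.asIdeal]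
  intro P hP
  rw [Multiset.mem_toFinset] at hP
  have hPp := prime_of_normalized_factor P hP
  exact Finset.mem_image.mpr
    ⟨⟨P, Ideal.isPrime_of_prime hPp, hPp.ne_zero⟩, hT _ hP, rfl⟩

section NumberField

variable {K : Type*} [Field K] [NumberField K]

lemma two_le_absNorm (p : HeightOneSpectrum (𝓞 K)) : 2 ≤ p.asIdeal.absNorm :=
  NumberField.HeightOneSpectrum.one_lt_absNorm p

open UniqueFactorizationMonoid in
lemma sum_inv_absNorm_le_exp (S : Finset (Ideal (𝓞 K))) (hS : ∀ I ∈ S, I ≠ 0)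
    (h : Summable fun p : HeightOneSpectrum (𝓞 K) ↦ (p.asIdeal.absNorm : ℝ)⁻¹) :
    ∑ I ∈ S, (I.absNorm : ℝ)⁻¹ ≤
      Real.exp (2 * ∑' p : HeightOneSpectrum (𝓞 K), (p.asIdeal.absNorm : ℝ)⁻¹) := by
  classical
  obtain ⟨T, hT⟩ : ∃ T : Finset (HeightOneSpectrum (𝓞 K)),
      ∀ I ∈ S, ∀ p : HeightOneSpectrum (𝓞 K), p.asIdeal ∈ normalizedFactors I → p ∈ T :=
    ⟨S.biUnion fun I ↦ (normalizedFactors I).toFinset.preimage HeightOneSpectrum.asIdeal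
      fun _ _ _ _ ↦ HeightOneSpectrum.ext, fun I hI p hp ↦ Finset.mem_biUnion.mpr
        ⟨I, hI, Finset.mem_preimage.mpr (Multiset.mem_toFinset.mpr hp)⟩⟩
  obtain ⟨e, hfac⟩ : ∃ e : Ideal (𝓞 K) → T → ℕ, ∀ I ∈ S, I = ∏ p : T, p.1.asIdeal ^ e I p :=
    ⟨fun I p ↦ (normalizedFactors I).count p.1.asIdeal, fun I hI ↦
      eq_prod_pow_count_normalizedFactors (hS I hI) T (hT I hI)⟩
  obtain ⟨m, hm⟩ : ∃ m : ℕ, ∀ I ∈ S, ∀ p, e I p < m := by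
    refine ⟨∑ I ∈ S, ∑ p, e I p + 1, fun I hI p ↦ Nat.lt_succ_of_le ?_⟩
    exact (Finset.single_le_sum (f := e I) (fun _ _ ↦ zero_le) (Finset.mem_univ p)).trans <|
      Finset.single_le_sum (f := fun I ↦ ∑ p, e I p) (fun _ _ ↦ zero_le) hI
  have hinj : Set.InjOn e S := by
    intro I hI J hJ hIJ
    rw [hfac I hI, hfac J hJ, hIJ]
  calc ∑ I ∈ S, (I.absNorm : ℝ)⁻¹
      = ∑ I ∈ S, ∏ p : T, ((p.1.asIdeal.absNorm : ℝ)⁻¹) ^ e I p := by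
        refine Finset.sum_congr rfl fun I hI ↦ ?_
        conv_lhs => rw [hfac I hI]
        simp
    _ = ∑ x ∈ S.image e, ∏ p : T, ((p.1.asIdeal.absNorm : ℝ)⁻¹) ^ x p :=
        (Finset.sum_image (f := fun x : T → ℕ ↦
          ∏ p : T, ((p.1.asIdeal.absNorm : ℝ)⁻¹) ^ x p) hinj).symm
    _ ≤ ∑ x ∈ Fintype.piFinset fun _ : T ↦ Finset.range m,
          ∏ p : T, ((p.1.asIdeal.absNorm : ℝ)⁻¹) ^ x p := by
        refine Finset.sum_le_sum_of_subset_of_nonneg (fun x hx ↦ ?_) fun _ _ _ ↦ by positivity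
        obtain ⟨I, hI, rfl⟩ := Finset.mem_image.mp hx
        simpa using hm I hI
    _ = ∏ p : T, ∑ k ∈ Finset.range m, ((p.1.asIdeal.absNorm : ℝ)⁻¹) ^ k :=
        (Finset.prod_univ_sum _ _).symm
    _ ≤ ∏ p : T, Real.exp (2 * (p.1.asIdeal.absNorm : ℝ)⁻¹) := by
        refine Finset.prod_le_prod (fun _ _ ↦ by positivity) fun p _ ↦ ?_
        refine geom_sum_le_exp (by positivity) ?_ m
        rw [one_div]
        exact inv_anti₀ two_pos (mod_cast two_le_absNorm p.1)
    _ = Real.exp (2 * ∑ p ∈ T, (p.asIdeal.absNorm : ℝ)⁻¹) := by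
        rw [← Real.exp_sum, ← Finset.mul_sum,
          Finset.sum_coe_sort T fun p ↦ (p.asIdeal.absNorm : ℝ)⁻¹]
    _ ≤ _ := by
        gcongr
        exact h.sum_le_tsum _ fun _ _ ↦ by positivity

open nonZeroDivisors Filter Topology in
lemma not_summable_inv_absNorm_ideal :
    ¬ Summable fun I : (Ideal (𝓞 K))⁰ ↦ ((I : Ideal (𝓞 K)).absNorm : ℝ)⁻¹ := by
  intro h
  have hlim := NumberField.Ideal.tendsto_norm_le_div_atTop₀ K
  rw [← NumberField.dedekindZeta_residue_def] at hlim
  have hκ := NumberField.dedekindZeta_residue_pos K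
  set κ := NumberField.dedekindZeta_residue K
  obtain ⟨s, hs⟩ := summable_iff_vanishing_norm.mp h (κ / 2) (half_pos hκ)
  have hbound : ∀ᶠ x : ℝ in atTop, (Nat.card {I : (Ideal (𝓞 K))⁰ //
      ((I : Ideal (𝓞 K)).absNorm : ℝ) ≤ x} : ℝ) / x ≤ s.card / x + κ / 2 := by
    filter_upwards [eventually_gt_atTop 0] with x hx
    have hfin : {I : (Ideal (𝓞 K))⁰ | ((I : Ideal (𝓞 K)).absNorm : ℝ) ≤ x}.Finite := by
      refine ((Ideal.finite_setOfPred_absNorm_le (S := 𝓞 K) ⌊x⌋₊).preimage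
        Subtype.val_injective.injOn).subset fun I hI ↦ ?_
      exact Nat.le_floor hI
    have hcard : Nat.card {I : (Ideal (𝓞 K))⁰ // ((I : Ideal (𝓞 K)).absNorm : ℝ) ≤ x} =
        hfin.toFinset.card := Nat.card_eq_card_finite_toFinset hfin
    have h1 : (hfin.toFinset.card : ℝ) ≤ s.card + (hfin.toFinset \ s).card := by
      have := Finset.card_le_card_sdiff_add_card (s := hfin.toFinset) (t := s)
      exact_mod_cast this.trans_eq (add_comm _ _)
    have h2 : ((hfin.toFinset \ s).card : ℝ) / x ≤ κ / 2 := by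
      refine le_trans ?_ ((le_abs_self _).trans (hs (hfin.toFinset \ s) Finset.sdiff_disjoint).le)
      rw [div_eq_mul_inv, ← nsmul_eq_mul]
      refine Finset.card_nsmul_le_sum _ _ _ fun I hI ↦ ?_
      refine inv_anti₀ ?_ ?_
      · exact_mod_cast Nat.pos_of_ne_zero (Ideal.absNorm_ne_zero_of_nonZeroDivisors I)
      · simpa using (Finset.mem_sdiff.mp hI).1
    rw [hcard]
    calc (hfin.toFinset.card : ℝ) / x ≤ (s.card + (hfin.toFinset \ s).card) / x := by gcongr
      _ ≤ _ := by rw [add_div]; gcongr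
  have hlim' : Tendsto (fun x : ℝ ↦ s.card / x + κ / 2) atTop (𝓝 (0 + κ / 2)) :=
    (tendsto_const_nhds.div_atTop tendsto_id).add tendsto_const_nhds
  have := le_of_tendsto_of_tendsto hlim hlim' hbound
  linarith

open nonZeroDivisors in
lemma not_summable_inv_absNorm :
    ¬ Summable fun p : HeightOneSpectrum (𝓞 K) ↦ (p.asIdeal.absNorm : ℝ)⁻¹ := by
  classical
  intro h
  refine not_summable_inv_absNorm_ideal (K := K) <|
    summable_of_sum_le (c := Real.exp (2 * ∑' p : HeightOneSpectrum (𝓞 K),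
      (p.asIdeal.absNorm : ℝ)⁻¹)) (fun _ ↦ by positivity) fun S ↦ ?_
  refine le_trans (le_of_eq ?_) <|
    sum_inv_absNorm_le_exp (S.image Subtype.val) (fun I hI ↦ ?_) h
  · rw [Finset.sum_image Subtype.val_injective.injOn]
  · obtain ⟨J, -, rfl⟩ := Finset.mem_image.mp hI
    exact nonZeroDivisors.ne_zero J.2

lemma summable_inv_absNorm_sq :
    Summable fun p : HeightOneSpectrum (𝓞 K) ↦ ((p.asIdeal.absNorm : ℝ) ^ 2)⁻¹ := by
  have hinj : Function.Injective fun p : HeightOneSpectrum ℤ ↦ p.asIdeal.absNorm := by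
    intro p q h
    refine HeightOneSpectrum.ext ?_
    rw [← Int.ideal_span_absNorm_eq_self p.asIdeal, ← Int.ideal_span_absNorm_eq_self q.asIdeal]
    exact congrArg (fun n : ℕ ↦ Ideal.span {(n : ℤ)}) h
  have hsum : Summable fun p : HeightOneSpectrum ℤ ↦ ((p.asIdeal.absNorm : ℝ) ^ 2)⁻¹ :=
    (Real.summable_nat_pow_inv.mpr one_lt_two).comp_injective hinj
  refine summable_of_card_fiber_le (HeightOneSpectrum.under ℤ) _
    HeightOneSpectrum.card_fiber_under_le (fun _ ↦ by positivity) (fun _ ↦ by positivity)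
    (fun p ↦ ?_) hsum
  have hpos : 0 < (p.under ℤ).asIdeal.absNorm :=
    Nat.pos_of_ne_zero (Ideal.absNorm_eq_zero_iff.not.mpr (p.under ℤ).ne_bot)
  have hle : (p.under ℤ).asIdeal.absNorm ≤ p.asIdeal.absNorm :=
    Nat.le_of_dvd (by have := two_le_absNorm p; lia) (Int.absNorm_under_dvd_absNorm p.asIdeal)
  gcongr

end NumberField

section Extension

variable (K L : Type*) [Field K] [NumberField K] [Field L] [NumberField L] [Algebra K L]

lemma inertiaDeg_le_finrank (q : HeightOneSpectrum (𝓞 L)) :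
    q.asIdeal.inertiaDeg (𝓞 K) ≤ Module.finrank K L := by
  let p := q.under (𝓞 K)
  have := p.isMaximal
  have : Fintype (p.asIdeal.primesOver (𝓞 L)) := Fintype.ofFinite _
  rw [IsFractionRing.finrank_eq (𝓞 K) K (𝓞 L) L,
    ← Ideal.sum_ramification_inertia_eq_finrank (S := 𝓞 L) p.asIdeal]
  have hmem : q.asIdeal ∈ p.asIdeal.primesOver (𝓞 L) := ⟨q.isPrime, ⟨rfl⟩⟩
  refine le_trans ?_ (Finset.single_le_sum
    (f := fun r : p.asIdeal.primesOver (𝓞 L) ↦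
      r.1.ramificationIdx (𝓞 K) * r.1.inertiaDeg (𝓞 K))
    (fun _ _ ↦ zero_le) (Finset.mem_univ ⟨q.asIdeal, hmem⟩))
  have := q.isPrime
  exact Nat.le_mul_of_pos_left _ (Ideal.ramificationIdx_pos _ _)

/-- The set of primes of `K` with a prime of `L` of relative degree one above them. -/
def primesWithDegreeOneFactor : Set (HeightOneSpectrum (𝓞 K)) :=
  {p | ∃ q : HeightOneSpectrum (𝓞 L), q.under (𝓞 K) = p ∧
    q.asIdeal.absNorm = p.asIdeal.absNorm}

lemma absNorm_under_pow_inertiaDeg (q : HeightOneSpectrum (𝓞 L)) :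
    (q.under (𝓞 K)).asIdeal.absNorm ^ q.asIdeal.inertiaDeg (𝓞 K) = q.asIdeal.absNorm := by
  have := q.isPrime
  have : q.asIdeal.LiesOver (q.under (𝓞 K)).asIdeal := ⟨rfl⟩
  exact Ideal.absNorm_pow_inertiaDeg _ _

lemma not_summable_indicator_primesWithDegreeOneFactor :
    ¬ Summable ((primesWithDegreeOneFactor K L).indicator
      fun p ↦ (p.asIdeal.absNorm : ℝ)⁻¹) := by
  intro h
  refine not_summable_inv_absNorm (K := L) <| summable_of_card_fiber_le
    (HeightOneSpectrum.under (𝓞 K)) _ HeightOneSpectrum.card_fiber_under_le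
    (fun _ ↦ by positivity)
    (fun p ↦ add_nonneg (Set.indicator_nonneg (fun _ _ ↦ by positivity) p) (by positivity))
    (fun q ↦ ?_) (h.add summable_inv_absNorm_sq)
  have hN := absNorm_under_pow_inertiaDeg K L q
  have hp := two_le_absNorm (q.under (𝓞 K))
  have := q.isPrime
  have hf := Ideal.inertiaDeg_pos q.asIdeal (𝓞 K)
  by_cases hmem : q.under (𝓞 K) ∈ primesWithDegreeOneFactor K L
  · rw [Set.indicator_of_mem hmem]
    have : (q.under (𝓞 K)).asIdeal.absNorm ≤ q.asIdeal.absNorm := by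
      rw [← hN]
      exact Nat.le_self_pow hf.ne' _
    have : (q.asIdeal.absNorm : ℝ)⁻¹ ≤ ((q.under (𝓞 K)).asIdeal.absNorm : ℝ)⁻¹ := by
      gcongr
    exact this.trans (le_add_of_nonneg_right (by positivity))
  · rw [Set.indicator_of_notMem hmem, zero_add]
    have hf2 : 2 ≤ q.asIdeal.inertiaDeg (𝓞 K) := by
      by_contra! hlt
      have h1 : q.asIdeal.inertiaDeg (𝓞 K) = 1 := by lia
      rw [h1, pow_one] at hN
      exact hmem ⟨q, rfl, hN.symm⟩
    rw [← hN]
    push_cast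
    gcongr
    exact_mod_cast one_le_two.trans hp

lemma finprod_primesOver_eq (p : HeightOneSpectrum (𝓞 K)) (f : Ideal (𝓞 L) → ℝ) :
    ∏ᶠ (q : Ideal (𝓞 L)) (_ : q.IsPrime ∧ q ≠ ⊥ ∧
        q ∣ Ideal.map (algebraMap (𝓞 K) (𝓞 L)) p.asIdeal), f q =
      ∏ q ∈ IsDedekindDomain.primesOverFinset p.asIdeal (𝓞 L), f q := by
  have := p.isMaximal
  rw [← finprod_mem_coe_finset, IsDedekindDomain.coe_primesOverFinset p.ne_bot]
  refine finprod_congr fun q ↦ finprod_congr_Prop (propext ⟨fun h ↦ ?_, fun h ↦ ?_⟩) fun _ ↦ rfl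
  · exact ⟨h.1, (Ideal.liesOver_iff_dvd_map h.1.ne_top).mpr h.2.2⟩
  · exact ⟨h.1, Ideal.ne_bot_of_mem_primesOver p.ne_bot h,
      (Ideal.liesOver_iff_dvd_map h.1.ne_top).mp h.2⟩

variable {K L}

lemma one_sub_div_le_local_factor (p : HeightOneSpectrum (𝓞 K)) {β : ℝ} (hβ : 0 < β)
    {a : ℝ} (ha : 0 ≤ a) (q : HeightOneSpectrum (𝓞 L)) (hq : q.under (𝓞 K) = p) :
    a / (1 - (q.asIdeal.absNorm : ℝ) ^ (-β)) ≤
      a / ∏ᶠ (q : Ideal (𝓞 L)) (_ : q.IsPrime ∧ q ≠ ⊥ ∧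
        q ∣ Ideal.map (algebraMap (𝓞 K) (𝓞 L)) p.asIdeal), (1 - (q.absNorm : ℝ) ^ (-β)) := by
  have := p.isMaximal
  rw [finprod_primesOver_eq]
  have hmem : ∀ r ∈ IsDedekindDomain.primesOverFinset p.asIdeal (𝓞 L),
      0 < 1 - (r.absNorm : ℝ) ^ (-β) ∧ 1 - (r.absNorm : ℝ) ^ (-β) ≤ 1 := by
    intro r hr
    have hr' := (IsDedekindDomain.mem_primesOverFinset_iff p.ne_bot _).mp hr
    have h2 := two_le_absNorm ⟨r, hr'.1, Ideal.ne_bot_of_mem_primesOver p.ne_bot hr'⟩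
    refine ⟨sub_pos.mpr (Real.rpow_lt_one_of_one_lt_of_neg ?_ (neg_neg_of_pos hβ)),
      sub_le_self _ (by positivity)⟩
    exact_mod_cast one_lt_two.trans_le h2
  have hqmem : q.asIdeal ∈ IsDedekindDomain.primesOverFinset p.asIdeal (𝓞 L) :=
    (IsDedekindDomain.mem_primesOverFinset_iff p.ne_bot _).mpr ⟨q.isPrime, ⟨by rw [← hq]; rfl⟩⟩
  refine div_le_div_of_nonneg_left ha (Finset.prod_pos fun r hr ↦ (hmem r hr).1) ?_
  rw [← Finset.mul_prod_erase _ _ hqmem]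
  refine mul_le_of_le_one_right (hmem _ hqmem).1.le (Finset.prod_le_one (fun r hr ↦ ?_)
    fun r hr ↦ ?_)
  · exact (hmem r (Finset.mem_of_mem_erase hr)).1.le
  · exact (hmem r (Finset.mem_of_mem_erase hr)).2

lemma one_add_indicator_le_local_factor (hn : 2 ≤ Module.finrank K L) {β : ℝ} (hβ0 : 0 < β)
    (hβ1 : β ≤ 1) (p : HeightOneSpectrum (𝓞 K)) :
    1 + (primesWithDegreeOneFactor K L).indicator (fun p ↦ (p.asIdeal.absNorm : ℝ)⁻¹) p ≤
      (1 - (p.asIdeal.absNorm : ℝ) ^ (-((Module.finrank K L : ℝ) * β))) /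
        ∏ᶠ (q : Ideal (𝓞 L)) (_ : q.IsPrime ∧ q ≠ ⊥ ∧
          q ∣ Ideal.map (algebraMap (𝓞 K) (𝓞 L)) p.asIdeal), (1 - (q.absNorm : ℝ) ^ (-β)) := by
  have hp : (1 : ℝ) < p.asIdeal.absNorm := mod_cast one_lt_two.trans_le (two_le_absNorm p)
  set x : ℝ := (p.asIdeal.absNorm : ℝ) ^ (-β) with hx
  have hx0 : 0 < x := by positivity
  have hx1 : x < 1 := Real.rpow_lt_one_of_one_lt_of_neg hp (neg_neg_of_pos hβ0)
  have hpow : ∀ m : ℕ, (p.asIdeal.absNorm : ℝ) ^ (-((m : ℝ) * β)) = x ^ m := fun m ↦ by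
    rw [hx, ← Real.rpow_mul_natCast (by positivity)]
    ring_nf
  rw [hpow]
  have hxn : 0 ≤ 1 - x ^ Module.finrank K L := sub_nonneg.mpr (pow_le_one₀ hx0.le hx1.le)
  by_cases hmem : p ∈ primesWithDegreeOneFactor K L
  · rw [Set.indicator_of_mem hmem]
    obtain ⟨q, hq, hqN⟩ := hmem
    refine le_trans ?_ (one_sub_div_le_local_factor p hβ0 hxn q hq)
    rw [hqN, ← hx, le_div_iff₀ (sub_pos.mpr hx1)]
    have h1 : (p.asIdeal.absNorm : ℝ)⁻¹ ≤ x := by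
      rw [← Real.rpow_neg_one]
      exact Real.rpow_le_rpow_of_exponent_le hp.le (neg_le_neg hβ1)
    have h2 : x ^ Module.finrank K L ≤ x ^ 2 := pow_le_pow_of_le_one hx0.le hx1.le hn
    nlinarith
  · rw [Set.indicator_of_notMem hmem, add_zero]
    have := p.isMaximal
    obtain ⟨P, hP⟩ := (inferInstance : Nonempty (p.asIdeal.primesOver (𝓞 L)))
    let q : HeightOneSpectrum (𝓞 L) := ⟨P, hP.1, Ideal.ne_bot_of_mem_primesOver p.ne_bot hP⟩
    have hq : q.under (𝓞 K) = p := HeightOneSpectrum.ext hP.2.over.symm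
    refine le_trans ?_ (one_sub_div_le_local_factor p hβ0 hxn q hq)
    have hqN : (q.asIdeal.absNorm : ℝ) ^ (-β) = x ^ q.asIdeal.inertiaDeg (𝓞 K) := by
      rw [← hpow, ← absNorm_under_pow_inertiaDeg K L q, hq, Nat.cast_pow, ← Real.rpow_natCast,
        ← Real.rpow_mul (by positivity), mul_neg]
    have := q.isPrime
    have hf := Ideal.inertiaDeg_pos q.asIdeal (𝓞 K)
    rw [hqN, one_le_div (sub_pos.mpr (pow_lt_one₀ hx0.le hx1 hf.ne'))]
    exact sub_le_sub_left (pow_le_pow_of_le_one hx0.le hx1.le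
      (inertiaDeg_le_finrank K L q)) _

end Extension

/-- For an extension `L/K` of number fields with `K ≠ L`
(so `n = [L:K] ≥ 2`) and `0 < β ≤ 1`, the partial products
`∏_{𝔭 ∈ F} (1 - N_K(𝔭)^{-nβ}) / ∏_{𝔮 ∣ 𝔭𝓞_L} (1 - N_L(𝔮)^{-β})` over finite sets `F`
of nonzero primes of `𝓞_K` are unbounded above. -/
theorem partial_products_unbounded (K L : Type*) [Field K] [NumberField K]
    [Field L] [NumberField L] [Algebra K L] (hn : 2 ≤ Module.finrank K L)
    (β : ℝ) (hβ0 : 0 < β) (hβ1 : β ≤ 1) (C : ℝ) :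
    ∃ F : Finset (HeightOneSpectrum (𝓞 K)),
      C < ∏ p ∈ F,
        (1 - (Ideal.absNorm p.asIdeal : ℝ) ^ (-((Module.finrank K L : ℝ) * β))) /
          ∏ᶠ (q : Ideal (𝓞 L)) (_ : q.IsPrime ∧ q ≠ ⊥ ∧
              q ∣ Ideal.map (algebraMap (𝓞 K) (𝓞 L)) p.asIdeal),
            (1 - (Ideal.absNorm q : ℝ) ^ (-β)) := by
  have hnonneg : ∀ p : HeightOneSpectrum (𝓞 K), 0 ≤ (primesWithDegreeOneFactor K L).indicator
      (fun p ↦ (p.asIdeal.absNorm : ℝ)⁻¹) p := Set.indicator_nonneg fun _ _ ↦ by positivity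
  by_contra! hC
  refine not_summable_indicator_primesWithDegreeOneFactor K L <|
    summable_of_sum_le (c := C) hnonneg fun F ↦ ?_
  refine le_trans ?_ (hC F)
  refine (le_add_of_nonneg_left zero_le_one).trans <|
    (one_add_sum_le_prod_one_add F hnonneg).trans ?_
  exact Finset.prod_le_prod (fun p _ ↦ add_nonneg zero_le_one (hnonneg p))
    fun p _ ↦ one_add_indicator_le_local_factor hn hβ0 hβ1 p
end
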